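/- arXiv:2407.05911 — 2 statements merged into one kernel-verified Lean document; each statement's English description precedes it below -/
import Mathlib

section
/- Let 1 < p, q < ∞ and α ∈ ℝ with α ≥ d/p − d/q. Then the pair of power-law weights (|x|^β, |x|^γ) satisfies the A_{p,q}^α condition if and only if α − d/p + d/q = β/p − γ/q, β < d(p−1), and γ > −d. -/
open MeasureTheory ENNReal NNReal Set

noncomputable section

/-- A half-open axis-parallel cube in `ℝ^d`, given by its corner and (positive) sidelength. -/
structure Cube (d : ℕ) where
  corner : Fin d → ℝ
  side : ℝ
  side_pos : 0 < side

namespace Cube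

variable {d : ℕ}

/-- The set of points of the cube: `[x_1, x_1+l) × ⋯ × [x_d, x_d+l)`. -/
def toSet (Q : Cube d) : Set (Fin d → ℝ) :=
  {y | ∀ i, Q.corner i ≤ y i ∧ y i < Q.corner i + Q.side}

/-- The translate `Q + l(Q) m` of a cube. -/
def translate (Q : Cube d) (m : Fin d → ℤ) : Cube d :=
  ⟨fun i => Q.corner i + Q.side * (m i : ℝ), Q.side, Q.side_pos⟩

/-- The corner child `x(Q) + (1/2)(Q - x(Q))` of a cube. -/
def cornerChild (Q : Cube d) : Cube d :=
  ⟨Q.corner, Q.side / 2, by have := Q.side_pos; linarith⟩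

/-- The threefold expansion `x(Q) + 3(Q - x(Q))` of a cube from its corner. -/
def expand3 (Q : Cube d) : Cube d :=
  ⟨Q.corner, 3 * Q.side, by have := Q.side_pos; linarith⟩

/-- The dilate `D_c Q`: cube with the same center as `Q` and sidelength `c·l(Q)`. -/
def dilate (Q : Cube d) (c : ℝ) (hc : 0 < c) : Cube d :=
  ⟨fun i => Q.corner i + Q.side / 2 - c * Q.side / 2, c * Q.side, by
    have := Q.side_pos; positivity⟩

end Cube

/-- A dyadic lattice in `ℝ^d`: a family of generations of cubes, each generation formed by
all translates of one of its cubes, and each generation containing a cube whose corner child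
belongs to the next generation. -/
structure DyadicLattice (d : ℕ) where
  gen : ℤ → Set (Cube d)
  gen_translates : ∀ k, ∃ Q ∈ gen k, gen k = {R | ∃ m : Fin d → ℤ, R = Q.translate m}
  cornerChild_mem : ∀ k, ∃ Q ∈ gen k, Q.cornerChild ∈ gen (k + 1)

/-- The collection of all cubes of a dyadic lattice. -/
def DyadicLattice.cubes {d : ℕ} (D : DyadicLattice d) : Set (Cube d) := ⋃ k, D.gen k

/-- The quadrant of a dyadic lattice containing `x`: the union of all cubes of the lattice
containing `x`. -/
def DyadicLattice.quadrant {d : ℕ} (D : DyadicLattice d) (x : Fin d → ℝ) :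
    Set (Fin d → ℝ) :=
  ⋃ Q ∈ {Q : Cube d | Q ∈ D.cubes ∧ x ∈ Q.toSet}, Q.toSet

/-- A weight: a locally integrable, a.e. positive (and finite) function. -/
def IsWeight {d : ℕ} (w : (Fin d → ℝ) → ℝ) : Prop :=
  LocallyIntegrable w volume ∧ ∀ᵐ x ∂(volume : Measure (Fin d → ℝ)), 0 < w x

/-- The measure `w dx` associated to a weight. -/
def wMeasure {d : ℕ} (w : (Fin d → ℝ) → ℝ) : Measure (Fin d → ℝ) :=
  volume.withDensity fun x => ENNReal.ofReal (w x)

/-- `w(E) = ∫_E w dx`. -/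
def wInt {d : ℕ} (w : (Fin d → ℝ) → ℝ) (E : Set (Fin d → ℝ)) : ℝ≥0∞ :=
  ∫⁻ x in E, ENNReal.ofReal (w x)

/-- The `L^q` norm (with `q = ∞` allowed) of an `ℝ≥0∞`-valued function. -/
def eLpNormENN {X : Type*} [MeasurableSpace X] (g : X → ℝ≥0∞) (q : ℝ≥0∞)
    (μ : Measure X) : ℝ≥0∞ :=
  if q = ∞ then essSup g μ
  else (∫⁻ x, g x ^ q.toReal ∂μ) ^ (1 / q.toReal)

/-- The weak `L^q` quasinorm (with `q = ∞` allowed, interpreted as the `L^∞` norm) of an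
`ℝ≥0∞`-valued function: `sup_{t>0} t · μ{g > t}^{1/q}`. -/
def wnormENN {X : Type*} [MeasurableSpace X] (g : X → ℝ≥0∞) (q : ℝ≥0∞)
    (μ : Measure X) : ℝ≥0∞ :=
  if q = ∞ then essSup g μ
  else ⨆ t : ℝ≥0, (t : ℝ≥0∞) * μ {x | (t : ℝ≥0∞) < g x} ^ (1 / q.toReal)

/-- The weighted dyadic fractional maximal operator
`M^D_{α,w} f(x) = sup_{Q ∈ D, x ∈ Q} w(Q)^{α/d-1} ∫_Q |f| w`. -/
def MwDyadic {d : ℕ} (D : DyadicLattice d) (α : ℝ) (w f : (Fin d → ℝ) → ℝ)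
    (x : Fin d → ℝ) : ℝ≥0∞ :=
  ⨆ (Q : Cube d) (_ : Q ∈ D.cubes) (_ : x ∈ Q.toSet),
    wInt w Q.toSet ^ (α / (d : ℝ) - 1) *
      ∫⁻ y in Q.toSet, (‖f y‖₊ : ℝ≥0∞) * ENNReal.ofReal (w y)

/-- The dyadic fractional maximal operator `M^D_α f(x) = sup_{Q ∈ D, x ∈ Q} |Q|^{α/d} ⨍_Q |f|`. -/
def MfracDyadic {d : ℕ} (D : DyadicLattice d) (α : ℝ) (f : (Fin d → ℝ) → ℝ)
    (x : Fin d → ℝ) : ℝ≥0∞ :=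
  ⨆ (Q : Cube d) (_ : Q ∈ D.cubes) (_ : x ∈ Q.toSet),
    volume Q.toSet ^ (α / (d : ℝ) - 1) * ∫⁻ y in Q.toSet, (‖f y‖₊ : ℝ≥0∞)

/-- The fractional maximal operator `M_α f(x) = sup_{Q ∋ x} |Q|^{α/d} ⨍_Q |f|`,
supremum over all cubes containing `x`. -/
def Mfrac {d : ℕ} (α : ℝ) (f : (Fin d → ℝ) → ℝ) (x : Fin d → ℝ) : ℝ≥0∞ :=
  ⨆ (Q : Cube d) (_ : x ∈ Q.toSet),
    volume Q.toSet ^ (α / (d : ℝ) - 1) * ∫⁻ y in Q.toSet, (‖f y‖₊ : ℝ≥0∞)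

/-- The weighted fractional maximal operator
`M_{α,w} f(x) = sup_{Q ∋ x} w(Q)^{α/d-1} ∫_Q |f| w`, supremum over all cubes containing `x`. -/
def Mwfrac {d : ℕ} (α : ℝ) (w f : (Fin d → ℝ) → ℝ) (x : Fin d → ℝ) : ℝ≥0∞ :=
  ⨆ (Q : Cube d) (_ : x ∈ Q.toSet),
    wInt w Q.toSet ^ (α / (d : ℝ) - 1) *
      ∫⁻ y in Q.toSet, (‖f y‖₊ : ℝ≥0∞) * ENNReal.ofReal (w y)

/-- An `η`-sparse collection of cubes: each cube `Q` has a measurable subset `G(Q)` with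
`|G(Q)| ≥ η|Q|`, the sets `G(Q)` being pairwise disjoint. -/
def IsSparseCubes {d : ℕ} (η : ℝ) (S : Set (Cube d)) : Prop :=
  ∃ G : Cube d → Set (Fin d → ℝ),
    (∀ Q ∈ S, G Q ⊆ Q.toSet ∧ MeasurableSet (G Q) ∧
      ENNReal.ofReal η * volume Q.toSet ≤ volume (G Q)) ∧
    S.PairwiseDisjoint G

/-- The sparse operator `A_S^α f(x) = Σ_{Q ∈ S} χ_Q(x) |Q|^{α/d} ⨍_Q |f|`. -/
def sparseOp {d : ℕ} (α : ℝ) (S : Set (Cube d)) (f : (Fin d → ℝ) → ℝ)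
    (x : Fin d → ℝ) : ℝ≥0∞ :=
  ∑' Q : S, (Q : Cube d).toSet.indicator
    (fun _ => volume (Q : Cube d).toSet ^ (α / (d : ℝ) - 1) *
      ∫⁻ y in (Q : Cube d).toSet, (‖f y‖₊ : ℝ≥0∞)) x

/-- The `A_{p,q}^α` constant of a pair of weights:
`[v,w] = sup_Q |Q|^{α/d-1} (∫_Q v^{-p'/p})^{1/p'} (∫_Q w)^{1/q}` where `p' = p/(p-1)`. -/
def apqConst {d : ℕ} (p q α : ℝ) (v w : (Fin d → ℝ) → ℝ) : ℝ≥0∞ :=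
  ⨆ Q : Cube d,
    volume Q.toSet ^ (α / (d : ℝ) - 1) *
      (∫⁻ x in Q.toSet, ENNReal.ofReal (v x ^ (-(p / (p - 1)) / p))) ^ ((p - 1) / p) *
      (∫⁻ x in Q.toSet, ENNReal.ofReal (w x)) ^ (1 / q)

/-- The Muckenhoupt `A_∞` condition: `sup_Q exp(⨍_Q log w⁻¹) · ⨍_Q w < ∞`. -/
def IsAinfty {d : ℕ} (w : (Fin d → ℝ) → ℝ) : Prop :=
  ∃ C : ℝ, ∀ Q : Cube d,
    Real.exp (⨍ x in Q.toSet, Real.log (w x)⁻¹ ∂volume) *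
      (⨍ x in Q.toSet, w x ∂volume) ≤ C

/-- The Euclidean norm of a point of `ℝ^d`. -/
def euclNorm {d : ℕ} (x : Fin d → ℝ) : ℝ := Real.sqrt (∑ i, x i ^ 2)

/-- The auxiliary maximal operator `M_{T,λ}` controlling oscillations of truncations of `T`:
`M_{T,λ} f(x) = sup_{Q ∋ x} ess sup_{x',x'' ∈ Q} |T(fχ_{ℝ^d∖Q*})(x') − T(fχ_{ℝ^d∖Q*})(x'')|`. -/
def MT {d : ℕ} (T : ((Fin d → ℝ) → ℝ) → (Fin d → ℝ) → ℝ) (lam : ℝ) (hlam : 0 < lam)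
    (f : (Fin d → ℝ) → ℝ) (x : Fin d → ℝ) : ℝ≥0∞ :=
  ⨆ (Q : Cube d) (_ : x ∈ Q.toSet),
    essSup
      (fun z : (Fin d → ℝ) × (Fin d → ℝ) =>
        (‖T (((Q.dilate lam hlam).toSet)ᶜ.indicator f) z.1 -
            T (((Q.dilate lam hlam).toSet)ᶜ.indicator f) z.2‖₊ : ℝ≥0∞))
      ((volume.restrict Q.toSet).prod (volume.restrict Q.toSet))

end

section PowerIntegrals

variable {E : Type*} [NormedAddCommGroup E] [NormedSpace ℝ E] [FiniteDimensional ℝ E]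
  [Nontrivial E] [MeasurableSpace E] [BorelSpace E] (μ : Measure E) [μ.IsAddHaarMeasure]

open Metric Module

lemma integrableOn_ball_norm_rpow_iff {a R : ℝ} (hR : 0 < R) :
    IntegrableOn (fun x : E => ‖x‖ ^ a) (ball 0 R) μ ↔ -(finrank ℝ E : ℝ) < a := by
  have hd : 0 < finrank ℝ E := finrank_pos
  rw [integrableOn_fun_norm_addHaar μ (f := fun y : ℝ => y ^ a)]
  have hcongr : EqOn (fun y : ℝ => y ^ (finrank ℝ E - 1) • y ^ a)
      (fun y => y ^ ((finrank ℝ E : ℝ) - 1 + a)) (Ioo 0 R) := by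
    intro y hy
    simp only [smul_eq_mul]
    rw [Real.rpow_add hy.1, ← Real.rpow_natCast, Nat.cast_pred hd]
  rw [integrableOn_congr_fun hcongr measurableSet_Ioo,
    intervalIntegral.integrableOn_Ioo_rpow_iff hR]
  constructor <;> intro h <;> linarith

lemma setIntegral_ball_norm_rpow {a R : ℝ} (ha : -(finrank ℝ E : ℝ) < a) (hR : 0 < R) :
    ∫ x in ball (0 : E) R, ‖x‖ ^ a ∂μ =
      finrank ℝ E * μ.real (ball 0 1) / (finrank ℝ E + a) * R ^ (finrank ℝ E + a) := by
  have hd : 0 < finrank ℝ E := finrank_pos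
  have hball : (ball (0 : E) R).indicator (fun x => ‖x‖ ^ a) =
      fun x => (Iio R).indicator (fun y : ℝ => y ^ a) ‖x‖ := by
    ext x
    simp [indicator]
  have hcongr : EqOn (fun y : ℝ => y ^ (finrank ℝ E - 1) • (Iio R).indicator (fun y : ℝ => y ^ a) y)
      ((Iio R).indicator fun y => y ^ ((finrank ℝ E : ℝ) - 1 + a)) (Ioi 0) := by
    intro y hy
    by_cases hyR : y < R
    · simp only [smul_eq_mul, indicator_of_mem (show y ∈ Iio R from hyR)]
      rw [Real.rpow_add hy, ← Real.rpow_natCast, Nat.cast_pred hd]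
    · simp [hyR]
  rw [← integral_indicator measurableSet_ball, hball, integral_fun_norm_addHaar,
    setIntegral_congr_fun measurableSet_Ioi hcongr, setIntegral_indicator measurableSet_Iio,
    Ioi_inter_Iio, ← integral_Ioc_eq_integral_Ioo, ← intervalIntegral.integral_of_le hR.le,
    integral_rpow (Or.inl (by linarith)), Real.zero_rpow (by linarith)]
  have h1 : (finrank ℝ E : ℝ) - 1 + a + 1 = finrank ℝ E + a := by ring
  rw [h1, sub_zero]
  simp only [nsmul_eq_mul, smul_eq_mul]
  ring

lemma lintegral_ball_norm_rpow {a R : ℝ} (ha : -(finrank ℝ E : ℝ) < a) (hR : 0 < R) :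
    ∫⁻ x in ball (0 : E) R, ENNReal.ofReal (‖x‖ ^ a) ∂μ =
      ENNReal.ofReal
        (finrank ℝ E * μ.real (ball 0 1) / (finrank ℝ E + a) * R ^ (finrank ℝ E + a)) := by
  rw [← setIntegral_ball_norm_rpow μ ha hR, ofReal_integral_eq_lintegral_ofReal
    ((integrableOn_ball_norm_rpow_iff μ hR).2 ha)]
  exact ae_of_all _ fun x => by positivity

lemma lintegral_ball_norm_rpow_eq_top {a R : ℝ} (ha : a ≤ -(finrank ℝ E : ℝ)) (hR : 0 < R) :
    ∫⁻ x in ball (0 : E) R, ENNReal.ofReal (‖x‖ ^ a) ∂μ = ∞ := by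
  by_contra h
  refine ha.not_gt ((integrableOn_ball_norm_rpow_iff μ hR).1 ?_)
  refine (lintegral_ofReal_ne_top_iff_integrable ?_ (ae_of_all _ fun x => by positivity)).1 h
  exact (measurable_norm.pow_const a).aestronglyMeasurable

end PowerIntegrals

lemma Real.rpow_le_rpow_abs_mul_rpow {u v K : ℝ} (a : ℝ) (hK : 1 ≤ K) (hu : 0 ≤ u) (hv : 0 ≤ v)
    (huv : u ≤ K * v) (hvu : v ≤ K * u) : v ^ a ≤ K ^ |a| * u ^ a := by
  have hK0 : 0 < K := by linarith
  rcases hu.eq_or_lt with rfl | hu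
  · obtain rfl : v = 0 := by linarith
    exact le_mul_of_one_le_left (by positivity) (Real.one_le_rpow hK (abs_nonneg a))
  have hv : 0 < v := by
    by_contra! h
    nlinarith
  rcases le_total 0 a with ha | ha
  · rw [abs_of_nonneg ha, ← Real.mul_rpow hK0.le hu.le]
    exact Real.rpow_le_rpow hv.le hvu ha
  · rw [abs_of_nonpos ha, Real.rpow_neg hK0.le, ← Real.inv_rpow hK0.le,
      ← Real.mul_rpow (by positivity) hu.le]
    refine Real.rpow_le_rpow_of_nonpos (by positivity) ?_ ha
    rw [inv_mul_le_iff₀ hK0]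
    exact huv

lemma euclNorm_nonneg {d : ℕ} (x : Fin d → ℝ) : 0 ≤ euclNorm x := Real.sqrt_nonneg _

lemma norm_le_euclNorm {d : ℕ} (x : Fin d → ℝ) : ‖x‖ ≤ euclNorm x := by
  refine (pi_norm_le_iff_of_nonneg (euclNorm_nonneg x)).2 fun i => ?_
  refine Real.abs_le_sqrt ?_
  exact Finset.single_le_sum (f := fun i => x i ^ 2) (fun i _ => sq_nonneg _) (Finset.mem_univ i)

lemma euclNorm_le_mul_norm {d : ℕ} (x : Fin d → ℝ) : euclNorm x ≤ d * ‖x‖ := by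
  refine Real.sqrt_le_iff.2 ⟨by positivity, ?_⟩
  have h : ∑ i, x i ^ 2 ≤ d * ‖x‖ ^ 2 := by
    have := Finset.sum_le_card_nsmul Finset.univ (fun i => x i ^ 2) (‖x‖ ^ 2) fun i _ =>
      sq_le_sq' (abs_le.1 (norm_le_pi_norm x i)).1 (abs_le.1 (norm_le_pi_norm x i)).2
    simpa using this
  refine h.trans ?_
  rw [mul_pow]
  gcongr
  exact_mod_cast Nat.le_self_pow two_ne_zero d

namespace Cube

variable {d : ℕ} (Q : Cube d)

lemma toSet_eq_pi : Q.toSet = univ.pi fun i => Ico (Q.corner i) (Q.corner i + Q.side) := by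
  ext y
  simp [toSet]

lemma volume_toSet : volume Q.toSet = ENNReal.ofReal (Q.side ^ d) := by
  rw [toSet_eq_pi, volume_pi_pi, ENNReal.ofReal_pow Q.side_pos.le]
  simp

lemma norm_sub_corner_le {y : Fin d → ℝ} (hy : y ∈ Q.toSet) : ‖y - Q.corner‖ ≤ Q.side := by
  refine (pi_norm_le_iff_of_nonneg Q.side_pos.le).2 fun i => ?_
  have := hy i
  rw [Pi.sub_apply, Real.norm_eq_abs, abs_le]
  constructor <;> linarith [Q.side_pos]

/-- The cube `[-l, l) × ⋯ × [-l, l)`. -/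
def centered (d : ℕ) (l : ℝ) (hl : 0 < l) : Cube d := ⟨fun _ => -l, 2 * l, by positivity⟩

lemma ball_subset_centered {l : ℝ} (hl : 0 < l) : Metric.ball 0 l ⊆ (centered d l hl).toSet := by
  intro y hy i
  have h := abs_lt.1 ((norm_le_pi_norm y i).trans_lt (mem_ball_zero_iff.1 hy))
  simp only [centered]
  constructor <;> linarith

end Cube

section EuclNormPower

variable {d : ℕ}

lemma euclNorm_rpow_le (hd : 0 < d) (a : ℝ) (x : Fin d → ℝ) :
    euclNorm x ^ a ≤ (d : ℝ) ^ |a| * ‖x‖ ^ a := by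
  have h1 : (1 : ℝ) ≤ d := by exact_mod_cast hd
  exact Real.rpow_le_rpow_abs_mul_rpow a h1 (norm_nonneg x) (euclNorm_nonneg x)
    ((norm_le_euclNorm x).trans (le_mul_of_one_le_left (euclNorm_nonneg x) h1))
    (euclNorm_le_mul_norm x)

lemma norm_rpow_le_euclNorm_rpow (hd : 0 < d) (a : ℝ) (x : Fin d → ℝ) :
    ‖x‖ ^ a ≤ (d : ℝ) ^ |a| * euclNorm x ^ a := by
  have h1 : (1 : ℝ) ≤ d := by exact_mod_cast hd
  exact Real.rpow_le_rpow_abs_mul_rpow a h1 (euclNorm_nonneg x) (norm_nonneg x)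
    (euclNorm_le_mul_norm x)
    ((norm_le_euclNorm x).trans (le_mul_of_one_le_left (euclNorm_nonneg x) h1))

lemma lintegral_norm_rpow_le (hd : 0 < d) (a : ℝ) (s : Set (Fin d → ℝ)) :
    ∫⁻ x in s, ENNReal.ofReal (‖x‖ ^ a) ≤
      ENNReal.ofReal ((d : ℝ) ^ |a|) * ∫⁻ x in s, ENNReal.ofReal (euclNorm x ^ a) := by
  rw [← lintegral_const_mul' _ _ ofReal_ne_top]
  refine lintegral_mono fun x => ?_
  rw [← ENNReal.ofReal_mul (by positivity)]
  exact ENNReal.ofReal_le_ofReal (norm_rpow_le_euclNorm_rpow hd a x)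

lemma lintegral_euclNorm_rpow_le (hd : 0 < d) (a : ℝ) (s : Set (Fin d → ℝ)) :
    ∫⁻ x in s, ENNReal.ofReal (euclNorm x ^ a) ≤
      ENNReal.ofReal ((d : ℝ) ^ |a|) * ∫⁻ x in s, ENNReal.ofReal (‖x‖ ^ a) := by
  rw [← lintegral_const_mul' _ _ ofReal_ne_top]
  refine lintegral_mono fun x => ?_
  rw [← ENNReal.ofReal_mul (by positivity)]
  exact ENNReal.ofReal_le_ofReal (euclNorm_rpow_le hd a x)

lemma exists_lintegral_ball_norm_rpow (hd : 0 < d) {a : ℝ} (ha : -(d : ℝ) < a) :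
    ∃ B : ℝ, 0 < B ∧ ∀ R : ℝ, 0 < R →
      ∫⁻ x in Metric.ball (0 : Fin d → ℝ) R, ENNReal.ofReal (‖x‖ ^ a) =
        ENNReal.ofReal (B * R ^ (d + a)) := by
  have : Nonempty (Fin d) := ⟨⟨0, hd⟩⟩
  have hvol : 0 < volume.real (Metric.ball (0 : Fin d → ℝ) 1) :=
    ENNReal.toReal_pos (Metric.measure_ball_pos _ _ one_pos).ne' measure_ball_lt_top.ne
  have hda : 0 < (d : ℝ) + a := by linarith
  refine ⟨d * volume.real (Metric.ball (0 : Fin d → ℝ) 1) / (d + a), by positivity,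
    fun R hR => ?_⟩
  simpa using lintegral_ball_norm_rpow (volume : Measure (Fin d → ℝ)) (by simpa using ha) hR

lemma lintegral_euclNorm_rpow_centered_eq_top (hd : 0 < d) {a : ℝ} (ha : a ≤ -(d : ℝ)) {l : ℝ}
    (hl : 0 < l) :
    ∫⁻ x in (Cube.centered d l hl).toSet, ENNReal.ofReal (euclNorm x ^ a) = ∞ := by
  have : Nonempty (Fin d) := ⟨⟨0, hd⟩⟩
  have h := lintegral_ball_norm_rpow_eq_top (volume : Measure (Fin d → ℝ)) (by simpa using ha) hl
  have h' := lintegral_norm_rpow_le hd a (Metric.ball 0 l)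
  rw [h, top_le_iff, ENNReal.mul_eq_top] at h'
  refine eq_top_mono (lintegral_mono_set (Cube.ball_subset_centered hl)) ?_
  exact (h'.resolve_right fun h => ofReal_ne_top h.1).2

lemma exists_le_lintegral_euclNorm_rpow_centered (hd : 0 < d) (a : ℝ) :
    ∃ c : ℝ, 0 < c ∧ ∀ (l : ℝ) (hl : 0 < l), ENNReal.ofReal (c * l ^ (d + a)) ≤
      ∫⁻ x in (Cube.centered d l hl).toSet, ENNReal.ofReal (euclNorm x ^ a) := by
  rcases le_or_gt a (-(d : ℝ)) with ha | ha
  · refine ⟨1, one_pos, fun l hl => ?_⟩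
    rw [lintegral_euclNorm_rpow_centered_eq_top hd ha]
    exact le_top
  obtain ⟨B, hB, hint⟩ := exists_lintegral_ball_norm_rpow hd ha
  have hK : 0 < (d : ℝ) ^ |a| := by positivity
  refine ⟨((d : ℝ) ^ |a|)⁻¹ * B, by positivity, fun l hl => ?_⟩
  refine le_trans ?_ (lintegral_mono_set (Cube.ball_subset_centered hl))
  have h := lintegral_norm_rpow_le hd a (Metric.ball 0 l)
  rw [hint l hl] at h
  rw [mul_assoc, ENNReal.ofReal_mul (by positivity), ENNReal.ofReal_inv_of_pos hK]
  exact (ENNReal.inv_mul_le_iff (by simpa using hK) ofReal_ne_top).2 h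

lemma lintegral_euclNorm_rpow_le_of_corner_le (hd : 0 < d) {a : ℝ} (ha : -(d : ℝ) < a) :
    ∃ C : ℝ, 0 < C ∧ ∀ Q : Cube d, ‖Q.corner‖ ≤ 2 * Q.side →
      ∫⁻ x in Q.toSet, ENNReal.ofReal (euclNorm x ^ a) ≤
        ENNReal.ofReal (C * (max ‖Q.corner‖ Q.side ^ a * Q.side ^ d)) := by
  obtain ⟨B, hB, hint⟩ := exists_lintegral_ball_norm_rpow hd ha
  refine ⟨(d : ℝ) ^ |a| * B * 4 ^ (d + a) * 2 ^ |a|, by positivity, fun Q hQ => ?_⟩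
  have hl := Q.side_pos
  have hsub : Q.toSet ⊆ Metric.ball 0 (4 * Q.side) := by
    intro y hy
    have h := Q.norm_sub_corner_le hy
    have h' := norm_le_norm_add_norm_sub' y Q.corner
    rw [mem_ball_zero_iff]
    linarith
  refine (lintegral_mono_set hsub).trans ((lintegral_euclNorm_rpow_le hd a _).trans ?_)
  rw [hint _ (by positivity), ← ENNReal.ofReal_mul (by positivity)]
  refine ENNReal.ofReal_le_ofReal ?_
  set R := max ‖Q.corner‖ Q.side
  have hlR : Q.side ≤ R := le_max_right _ _
  have hRl : R ≤ 2 * Q.side := max_le hQ (by linarith)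
  have hR : 0 < R := by linarith
  have hla : Q.side ^ a ≤ 2 ^ |a| * R ^ a :=
    Real.rpow_le_rpow_abs_mul_rpow a one_le_two hR.le hl.le hRl (by linarith)
  rw [Real.mul_rpow (by norm_num) hl.le, Real.rpow_add hl, Real.rpow_natCast]
  calc (d : ℝ) ^ |a| * (B * (4 ^ ((d : ℝ) + a) * (Q.side ^ d * Q.side ^ a)))
      = (d : ℝ) ^ |a| * B * 4 ^ ((d : ℝ) + a) * Q.side ^ d * Q.side ^ a := by ring
    _ ≤ (d : ℝ) ^ |a| * B * 4 ^ ((d : ℝ) + a) * Q.side ^ d * (2 ^ |a| * R ^ a) := by gcongr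
    _ = _ := by ring

lemma lintegral_euclNorm_rpow_le_of_lt_corner (hd : 0 < d) (a : ℝ) (Q : Cube d)
    (hQ : 2 * Q.side < ‖Q.corner‖) :
    ∫⁻ x in Q.toSet, ENNReal.ofReal (euclNorm x ^ a) ≤
      ENNReal.ofReal ((2 * d) ^ |a| * (max ‖Q.corner‖ Q.side ^ a * Q.side ^ d)) := by
  have hl := Q.side_pos
  have h1 : (1 : ℝ) ≤ d := by exact_mod_cast hd
  rw [max_eq_left (by linarith)]
  have hpt : ∀ x ∈ Q.toSet, ENNReal.ofReal (euclNorm x ^ a) ≤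
      ENNReal.ofReal ((2 * d) ^ |a| * ‖Q.corner‖ ^ a) := by
    intro x hx
    have h := Q.norm_sub_corner_le hx
    have hle := norm_le_norm_add_norm_sub' x Q.corner
    have hge := norm_le_norm_add_norm_sub' Q.corner x
    rw [norm_sub_rev] at hge
    have hlow := norm_le_euclNorm x
    have hupp := euclNorm_le_mul_norm x
    refine ENNReal.ofReal_le_ofReal (Real.rpow_le_rpow_abs_mul_rpow a (by linarith)
      (norm_nonneg _) (euclNorm_nonneg x) ?_ ?_)
    · nlinarith [euclNorm_nonneg x]
    · nlinarith [euclNorm_nonneg x]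
  refine (setLIntegral_mono measurable_const hpt).trans ?_
  rw [setLIntegral_const, Q.volume_toSet, ← ENNReal.ofReal_mul (by positivity), mul_assoc]

lemma exists_lintegral_euclNorm_rpow_le (hd : 0 < d) {a : ℝ} (ha : -(d : ℝ) < a) :
    ∃ C : ℝ, 0 < C ∧ ∀ Q : Cube d,
      ∫⁻ x in Q.toSet, ENNReal.ofReal (euclNorm x ^ a) ≤
        ENNReal.ofReal (C * (max ‖Q.corner‖ Q.side ^ a * Q.side ^ d)) := by
  obtain ⟨C, hC, hnear⟩ := lintegral_euclNorm_rpow_le_of_corner_le hd ha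
  refine ⟨max C ((2 * d) ^ |a|), lt_max_of_lt_left hC, fun Q => ?_⟩
  have hl := Q.side_pos
  have hR : 0 < max ‖Q.corner‖ Q.side := lt_max_of_lt_right hl
  rcases le_or_gt ‖Q.corner‖ (2 * Q.side) with hQ | hQ
  · refine (hnear Q hQ).trans (ENNReal.ofReal_le_ofReal ?_)
    gcongr
    exact le_max_left _ _
  · refine (lintegral_euclNorm_rpow_le_of_lt_corner hd a Q hQ).trans
      (ENNReal.ofReal_le_ofReal ?_)
    gcongr
    exact le_max_right _ _

end EuclNormPower

lemma eq_zero_of_forall_mul_rpow_le {c t M : ℝ} (hc : 0 < c)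
    (h : ∀ l : ℝ, 0 < l → c * l ^ t ≤ M) : t = 0 := by
  by_contra ht
  have hM : 0 < M := (by positivity : 0 < c * 1 ^ t).trans_le (h 1 one_pos)
  have h' := h ((M / c + 1) ^ t⁻¹) (by positivity)
  rw [Real.rpow_inv_rpow (by positivity) ht, mul_add, mul_div_cancel₀ _ hc.ne'] at h'
  linarith

/-- The quantity whose supremum over all cubes is the `A_{p,q}^α` constant of
`(|x|^β, |x|^γ)`, with the exponent `-β/(p-1)` of the dual weight written as `σ`. -/
noncomputable def apqPowerTerm {d : ℕ} (p q α σ γ : ℝ) (Q : Cube d) : ℝ≥0∞ :=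
  volume Q.toSet ^ (α / (d : ℝ) - 1) *
    (∫⁻ x in Q.toSet, ENNReal.ofReal (euclNorm x ^ σ)) ^ ((p - 1) / p) *
    (∫⁻ x in Q.toSet, ENNReal.ofReal (euclNorm x ^ γ)) ^ (1 / q)

lemma apqConst_power_eq_iSup {d : ℕ} (p q α β γ : ℝ) (hp : 1 < p) :
    apqConst (d := d) p q α (fun x => euclNorm x ^ β) (fun x => euclNorm x ^ γ) =
      ⨆ Q : Cube d, apqPowerTerm p q α (-β / (p - 1)) γ Q := by
  have hexp : β * (-(p / (p - 1)) / p) = -β / (p - 1) := by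
    have : p - 1 ≠ 0 := by linarith
    field_simp
  simp only [apqConst, apqPowerTerm, ← Real.rpow_mul (euclNorm_nonneg _), hexp]

section PowerTerm

variable {d : ℕ} {p q α σ γ : ℝ}

lemma Cube.volume_toSet_rpow (hd : 0 < d) (Q : Cube d) (α : ℝ) :
    volume Q.toSet ^ (α / (d : ℝ) - 1) = ENNReal.ofReal (Q.side ^ (α - d)) := by
  have hd' : (d : ℝ) ≠ 0 := by positivity
  have hl := Q.side_pos
  rw [Q.volume_toSet, ENNReal.ofReal_rpow_of_pos (by positivity), ← Real.rpow_natCast,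
    ← Real.rpow_mul hl.le]
  congr 2
  field_simp

lemma exists_le_apqPowerTerm_centered (hd : 0 < d) (hp : 1 < p) (hq : 1 < q) (α σ γ : ℝ) :
    ∃ c : ℝ, 0 < c ∧ ∀ (l : ℝ) (hl : 0 < l),
      ENNReal.ofReal (c * l ^ (α - d + (d + σ) * ((p - 1) / p) + (d + γ) * (1 / q))) ≤
        apqPowerTerm p q α σ γ (Cube.centered d l hl) := by
  obtain ⟨c₁, hc₁, h₁⟩ := exists_le_lintegral_euclNorm_rpow_centered hd σ
  obtain ⟨c₂, hc₂, h₂⟩ := exists_le_lintegral_euclNorm_rpow_centered hd γ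
  have hp' : 0 ≤ (p - 1) / p := div_nonneg (by linarith) (by linarith)
  have hq' : 0 ≤ 1 / q := by positivity
  refine ⟨2 ^ (α - d) * c₁ ^ ((p - 1) / p) * c₂ ^ (1 / q), by positivity, fun l hl => ?_⟩
  have key : apqPowerTerm p q α σ γ (Cube.centered d l hl) ≥
      ENNReal.ofReal ((2 * l) ^ (α - d)) * ENNReal.ofReal (c₁ * l ^ (d + σ)) ^ ((p - 1) / p) *
        ENNReal.ofReal (c₂ * l ^ (d + γ)) ^ (1 / q) := by
    rw [apqPowerTerm, Cube.volume_toSet_rpow hd,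
      show (Cube.centered d l hl).side = 2 * l from rfl]
    gcongr
    · exact h₁ l hl
    · exact h₂ l hl
  refine le_of_eq_of_le ?_ key
  rw [ENNReal.ofReal_rpow_of_nonneg (by positivity) hp',
    ENNReal.ofReal_rpow_of_nonneg (by positivity) hq', ← ENNReal.ofReal_mul (by positivity),
    ← ENNReal.ofReal_mul (by positivity), Real.mul_rpow zero_le_two hl.le,
    Real.mul_rpow hc₁.le (by positivity), Real.mul_rpow hc₂.le (by positivity),
    ← Real.rpow_mul hl.le, ← Real.rpow_mul hl.le, Real.rpow_add hl, Real.rpow_add hl]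
  congr 1
  ring

lemma apqPowerTerm_centered_eq_top (hd : 0 < d) (hp : 1 < p) (hq : 1 < q)
    (h : σ ≤ -(d : ℝ) ∨ γ ≤ -(d : ℝ)) :
    apqPowerTerm p q α σ γ (Cube.centered d 1 one_pos) = ∞ := by
  have hp' : 0 < (p - 1) / p := div_pos (by linarith) (by linarith)
  have hq' : 0 < 1 / q := by positivity
  have hne : ∀ a : ℝ,
      ∫⁻ x in (Cube.centered d 1 one_pos).toSet, ENNReal.ofReal (euclNorm x ^ a) ≠ 0 := by
    intro a
    obtain ⟨c, hc, hle⟩ := exists_le_lintegral_euclNorm_rpow_centered hd a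
    refine ((ENNReal.ofReal_pos.2 ?_).trans_le (hle 1 one_pos)).ne'
    positivity
  have hvol : ENNReal.ofReal ((Cube.centered d 1 one_pos).side ^ (α - d)) ≠ 0 :=
    (ENNReal.ofReal_pos.2 (Real.rpow_pos_of_pos (Cube.side_pos _) _)).ne'
  have hrpow : ∀ a e : ℝ, 0 < e →
      (∫⁻ x in (Cube.centered d 1 one_pos).toSet, ENNReal.ofReal (euclNorm x ^ a)) ^ e ≠ 0 := by
    intro a e he
    simp [ENNReal.rpow_eq_zero_iff, hne a, he.not_gt]
  rw [apqPowerTerm, Cube.volume_toSet_rpow hd]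
  rcases h with h | h
  · rw [lintegral_euclNorm_rpow_centered_eq_top hd h, ENNReal.top_rpow_of_pos hp',
      ENNReal.mul_top hvol, ENNReal.top_mul (hrpow _ _ hq')]
  · rw [lintegral_euclNorm_rpow_centered_eq_top hd h, ENNReal.top_rpow_of_pos hq',
      ENNReal.mul_top (mul_ne_zero hvol (hrpow _ _ hp'))]

lemma exists_apqPowerTerm_le (hd : 0 < d) (hp : 1 < p) (hq : 1 < q) (hσ : -(d : ℝ) < σ)
    (hγ : -(d : ℝ) < γ)
    (hbal : α - d + (d + σ) * ((p - 1) / p) + (d + γ) * (1 / q) = 0)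
    (hs : σ * ((p - 1) / p) + γ * (1 / q) ≤ 0) :
    ∃ C : ℝ, ∀ Q : Cube d, apqPowerTerm p q α σ γ Q ≤ ENNReal.ofReal C := by
  obtain ⟨C₁, hC₁, h₁⟩ := exists_lintegral_euclNorm_rpow_le hd hσ
  obtain ⟨C₂, hC₂, h₂⟩ := exists_lintegral_euclNorm_rpow_le hd hγ
  have hp' : 0 ≤ (p - 1) / p := div_nonneg (by linarith) (by linarith)
  have hq' : 0 ≤ 1 / q := by positivity
  refine ⟨C₁ ^ ((p - 1) / p) * C₂ ^ (1 / q), fun Q => ?_⟩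
  specialize h₁ Q
  specialize h₂ Q
  have hl := Q.side_pos
  have hlR : Q.side ≤ max ‖Q.corner‖ Q.side := le_max_right _ _
  set R := max ‖Q.corner‖ Q.side
  set l := Q.side
  have hR : 0 < R := hl.trans_le hlR
  have key : apqPowerTerm p q α σ γ Q ≤
      ENNReal.ofReal (l ^ (α - d)) * ENNReal.ofReal (C₁ * (R ^ σ * l ^ d)) ^ ((p - 1) / p) *
        ENNReal.ofReal (C₂ * (R ^ γ * l ^ d)) ^ (1 / q) := by
    rw [apqPowerTerm, Cube.volume_toSet_rpow hd]
    gcongr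
  refine key.trans ?_
  rw [ENNReal.ofReal_rpow_of_nonneg (by positivity) hp',
    ENNReal.ofReal_rpow_of_nonneg (by positivity) hq', ← ENNReal.ofReal_mul (by positivity),
    ← ENNReal.ofReal_mul (by positivity)]
  refine ENNReal.ofReal_le_ofReal ?_
  have hle : R ^ (σ * ((p - 1) / p) + γ * (1 / q)) ≤ l ^ (σ * ((p - 1) / p) + γ * (1 / q)) :=
    Real.rpow_le_rpow_of_nonpos hl hlR hs
  calc l ^ (α - d) * (C₁ * (R ^ σ * l ^ d)) ^ ((p - 1) / p) * (C₂ * (R ^ γ * l ^ d)) ^ (1 / q)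
      = C₁ ^ ((p - 1) / p) * C₂ ^ (1 / q) *
          (l ^ (α - d + d * ((p - 1) / p) + d * (1 / q)) *
            R ^ (σ * ((p - 1) / p) + γ * (1 / q))) := by
        rw [Real.mul_rpow hC₁.le (by positivity), Real.mul_rpow hC₂.le (by positivity),
          Real.mul_rpow (by positivity) (by positivity),
          Real.mul_rpow (by positivity) (by positivity), ← Real.rpow_natCast,
          ← Real.rpow_mul hR.le, ← Real.rpow_mul hR.le, ← Real.rpow_mul hl.le,
          ← Real.rpow_mul hl.le, Real.rpow_add hl, Real.rpow_add hl, Real.rpow_add hR]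
        ring
    _ ≤ C₁ ^ ((p - 1) / p) * C₂ ^ (1 / q) *
          (l ^ (α - d + d * ((p - 1) / p) + d * (1 / q)) *
            l ^ (σ * ((p - 1) / p) + γ * (1 / q))) := by gcongr
    _ = C₁ ^ ((p - 1) / p) * C₂ ^ (1 / q) := by
        rw [← Real.rpow_add hl, show α - d + d * ((p - 1) / p) + d * (1 / q) +
          (σ * ((p - 1) / p) + γ * (1 / q)) = 0 by linarith, Real.rpow_zero, mul_one]

lemma iSup_apqPowerTerm_ne_top_iff (hd : 0 < d) (hp : 1 < p) (hq : 1 < q)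
    (hs : -(α - d + d * ((p - 1) / p) + d * (1 / q)) ≤ 0) :
    ⨆ Q : Cube d, apqPowerTerm p q α σ γ Q ≠ ∞ ↔
      α - d + (d + σ) * ((p - 1) / p) + (d + γ) * (1 / q) = 0 ∧
        -(d : ℝ) < σ ∧ -(d : ℝ) < γ := by
  constructor
  · intro hfin
    have hle : ∀ Q : Cube d, apqPowerTerm p q α σ γ Q ≤
        ENNReal.ofReal (⨆ Q : Cube d, apqPowerTerm p q α σ γ Q).toReal := by
      intro Q
      rw [ENNReal.ofReal_toReal hfin]
      exact le_iSup _ Q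
    have htop : ¬ (σ ≤ -(d : ℝ) ∨ γ ≤ -(d : ℝ)) := by
      intro h
      have h' := hle (Cube.centered d 1 one_pos)
      rw [apqPowerTerm_centered_eq_top hd hp hq h] at h'
      exact ofReal_ne_top (top_le_iff.1 h')
    push Not at htop
    refine ⟨?_, htop⟩
    obtain ⟨c, hc, hlow⟩ := exists_le_apqPowerTerm_centered hd hp hq α σ γ
    exact eq_zero_of_forall_mul_rpow_le hc fun l hl =>
      (ENNReal.ofReal_le_ofReal_iff ENNReal.toReal_nonneg).1 ((hlow l hl).trans (hle _))
  · rintro ⟨hbal, hσ, hγ⟩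
    obtain ⟨C, hC⟩ := exists_apqPowerTerm_le hd hp hq hσ hγ hbal (by linarith)
    exact ((iSup_le hC).trans_lt ofReal_lt_top).ne

end PowerTerm

/-- characterization of the `A_{p,q}^α` condition for power law weights. -/
theorem apq_alpha_power_weights
    {d : ℕ} (hd : 0 < d) (p q α β γ : ℝ) (hp : 1 < p) (hq : 1 < q)
    (hα : (d : ℝ) / p - (d : ℝ) / q ≤ α) :
    apqConst (d := d) p q α (fun x => euclNorm x ^ β) (fun x => euclNorm x ^ γ) ≠ ∞ ↔
      (α - (d : ℝ) / p + (d : ℝ) / q = β / p - γ / q ∧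
        β < (d : ℝ) * (p - 1) ∧ -(d : ℝ) < γ) := by
  have hp1 : 0 < p - 1 := by linarith
  have hp0 : p ≠ 0 := by linarith
  have hscale : α - d + d * ((p - 1) / p) + d * (1 / q) = α - d / p + d / q := by
    field_simp
    ring
  have hbal : α - d + (d + -β / (p - 1)) * ((p - 1) / p) + (d + γ) * (1 / q) =
      α - d / p + d / q - (β / p - γ / q) := by
    have hp1' : p - 1 ≠ 0 := hp1.ne'
    field_simp
    ring
  rw [apqConst_power_eq_iSup p q α β γ hp,
    iSup_apqPowerTerm_ne_top_iff hd hp hq (by rw [hscale]; linarith), hbal, sub_eq_zero,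
    lt_div_iff₀ hp1, neg_mul, neg_lt_neg_iff]
end

section
/- Let 1 < p, q < ∞ and α ∈ ℝ. The pair of monomial weights (|x_1|^{β_1}⋯|x_d|^{β_d}, |x_1|^{γ_1}⋯|x_d|^{γ_d}) on ℝ^d satisfies the A_{p,q}^α condition if and only if: (1) β_j < p−1 and γ_j > −1 for all j; (2) γ_j/q ≤ β_j/p for all j; and (3) α + d/q − d/p + Σ_{j=1}^d (γ_j/q − β_j/p) = 0. -/
open MeasureTheory ENNReal NNReal Set

/-- The mass of the interval `[a, a + l)` for the one-dimensional power weight `|x| ^ s`. -/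
noncomputable def powerMass (s a l : ℝ) : ℝ≥0∞ :=
  ∫⁻ x in Ico a (a + l), ENNReal.ofReal (|x| ^ s)

/-- Tonelli's theorem for a product of functions of one coordinate each. -/
theorem lintegral_fin_prod_eq_prod {n : ℕ} (μ : Fin n → Measure ℝ)
    [∀ i, SigmaFinite (μ i)] (f : Fin n → ℝ → ℝ≥0∞) (hf : ∀ i, Measurable (f i)) :
    ∫⁻ x, ∏ i, f i (x i) ∂(Measure.pi μ) = ∏ i, ∫⁻ x, f i x ∂(μ i) := by
  induction n with
  | zero => simp
  | succ n ih =>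
    calc
      _ = ∫⁻ x : ℝ × (Fin n → ℝ), f 0 x.1 * ∏ i : Fin n, f i.succ (x.2 i)
            ∂((μ 0).prod (Measure.pi fun i => μ i.succ)) := by
        rw [← (measurePreserving_piFinSuccAbove μ 0).symm.lintegral_comp_emb
          (MeasurableEquiv.measurableEmbedding _)]
        simp_rw [MeasurableEquiv.piFinSuccAbove_symm_apply, Fin.insertNthEquiv,
          Fin.prod_univ_succ, Fin.insertNth_zero]
        rfl
      _ = (∫⁻ x, f 0 x ∂μ 0) * ∏ i : Fin n, ∫⁻ x, f i.succ x ∂(μ i.succ) := by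
        rw [← ih (fun i => μ i.succ) (fun i => f i.succ) (fun i => hf _)]
        exact lintegral_prod_mul (hf 0).aemeasurable
          (Finset.measurable_prod Finset.univ fun (i : Fin n) _ =>
            (hf i.succ).comp (measurable_pi_apply i)).aemeasurable
      _ = _ := by rw [Fin.prod_univ_succ]

theorem Cube.toSet_eq_pi_s12 {d : ℕ} (Q : Cube d) :
    Q.toSet = Set.univ.pi fun i => Ico (Q.corner i) (Q.corner i + Q.side) := by
  ext y
  simp [Cube.toSet]

theorem Cube.volume_toSet_s12 {d : ℕ} (Q : Cube d) :
    volume Q.toSet = ENNReal.ofReal Q.side ^ d := by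
  rw [Q.toSet_eq_pi_s12, volume_pi_pi]
  simp

theorem Cube.lintegral_monomial {d : ℕ} (Q : Cube d) (s : Fin d → ℝ) :
    ∫⁻ x in Q.toSet, ENNReal.ofReal (∏ j, |x j| ^ s j) =
      ∏ j, powerMass (s j) (Q.corner j) Q.side := by
  rw [Q.toSet_eq_pi_s12, volume_pi, Measure.restrict_pi_pi]
  simp_rw [ENNReal.ofReal_prod_of_nonneg fun i _ => Real.rpow_nonneg (abs_nonneg _) (s i)]
  exact lintegral_fin_prod_eq_prod _ (fun i x => ENNReal.ofReal (|x| ^ s i))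
    fun i => by fun_prop

theorem powerMass_pos (s a : ℝ) {l : ℝ} (hl : 0 < l) : 0 < powerMass s a l := by
  refine (setLIntegral_pos_iff (by fun_prop)).2 ?_
  have h : Ioo a (a + l) \ {0} ⊆
      (Function.support fun x : ℝ => ENNReal.ofReal (|x| ^ s)) ∩ Ico a (a + l) := by
    rintro x ⟨hx, hx0⟩
    refine ⟨?_, hx.1.le, hx.2⟩
    simpa using Real.rpow_pos_of_pos (abs_pos.2 hx0) s
  refine lt_of_lt_of_le ?_ (measure_mono h)
  rw [measure_sdiff_null (by simp)]
  simpa using hl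

theorem powerMass_zero_eq_setLIntegral_Ioo (s l : ℝ) :
    powerMass s 0 l = ∫⁻ x in Ioo 0 l, ENNReal.ofReal (x ^ s) := by
  rw [powerMass, zero_add, setLIntegral_congr Ioo_ae_eq_Ico.symm]
  refine setLIntegral_congr_fun measurableSet_Ioo fun x hx => ?_
  simp only [abs_of_pos hx.1]

theorem neg_one_lt_of_powerMass_ne_top {s l : ℝ} (hl : 0 < l) (h : powerMass s 0 l ≠ ∞) :
    -1 < s := by
  rw [powerMass_zero_eq_setLIntegral_Ioo] at h
  rw [← intervalIntegral.integrableOn_Ioo_rpow_iff hl]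
  refine (lintegral_ofReal_ne_top_iff_integrable (by fun_prop) ?_).1 h
  filter_upwards [self_mem_ae_restrict measurableSet_Ioo] with x hx
  exact Real.rpow_nonneg hx.1.le s

theorem powerMass_zero {s l : ℝ} (hs : -1 < s) (hl : 0 < l) :
    powerMass s 0 l = ENNReal.ofReal (1 / (s + 1)) * ENNReal.ofReal l ^ (s + 1) := by
  have h := (intervalIntegral.integrableOn_Ioo_rpow_iff hl).2 hs
  rw [powerMass_zero_eq_setLIntegral_Ioo, ← ofReal_integral_eq_lintegral_ofReal h,
    ← integral_Ioc_eq_integral_Ioo, ← intervalIntegral.integral_of_le hl.le,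
    integral_rpow (Or.inl hs), Real.zero_rpow (by linarith), ENNReal.ofReal_rpow_of_pos hl,
    ← ENNReal.ofReal_mul (by have : 0 < s + 1 := by linarith
                             positivity)]
  · congr 1
    ring
  · filter_upwards [self_mem_ae_restrict measurableSet_Ioo] with x hx
    exact Real.rpow_nonneg hx.1.le s

theorem powerMass_neg_le (s R : ℝ) : powerMass s (-R) R ≤ powerMass s 0 R := by
  rw [powerMass, powerMass, setLIntegral_congr Ioo_ae_eq_Ico.symm,
    ← (Measure.measurePreserving_neg (volume : Measure ℝ)).setLIntegral_comp_preimage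
      measurableSet_Ioo (by fun_prop)]
  simp only [abs_neg]
  refine lintegral_mono_set fun x hx => ?_
  simp only [mem_preimage, mem_Ioo, mem_Ico] at hx ⊢
  constructor <;> linarith [hx.1, hx.2]

theorem powerMass_le_two_mul {s a l R : ℝ} (h₁ : -R ≤ a) (h₂ : a + l ≤ R) :
    powerMass s a l ≤ 2 * powerMass s 0 R := by
  have h : Ico a (a + l) ⊆ Ico (-R) (-R + R) ∪ Ico 0 (0 + R) := by
    intro x hx
    rcases lt_or_ge x 0 with h | h
    · exact Or.inl ⟨h₁.trans hx.1, by linarith⟩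
    · exact Or.inr ⟨h, by linarith [hx.2]⟩
  calc powerMass s a l ≤ powerMass s (-R) R + powerMass s 0 R :=
        (lintegral_mono_set h).trans (lintegral_union_le _ _ _)
    _ ≤ powerMass s 0 R + powerMass s 0 R := by gcongr; exact powerMass_neg_le s R
    _ = _ := (two_mul _).symm

theorem Real.rpow_le_mul_rpow_of_comparable {x y k : ℝ} (s : ℝ) (hx : 0 < x) (hy : 0 < y)
    (hxy : x ≤ k * y) (hyx : y ≤ k * x) : x ^ s ≤ k ^ |s| * y ^ s := by
  have hk : 0 < k := pos_of_mul_pos_left (hx.trans_le hxy) hy.le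
  rcases le_total 0 s with h | h
  · rw [abs_of_nonneg h, ← Real.mul_rpow hk.le hy.le]
    exact Real.rpow_le_rpow hx.le hxy h
  · have h1 : (k * x) ^ s ≤ y ^ s := Real.rpow_le_rpow_of_nonpos hy hyx h
    rw [Real.mul_rpow hk.le hx.le] at h1
    calc x ^ s = k ^ |s| * (k ^ s * x ^ s) := by
          rw [← mul_assoc, ← Real.rpow_add hk, abs_of_nonpos h]; simp
      _ ≤ _ := by gcongr

theorem powerMass_le {s : ℝ} (hs : -1 < s) : ∃ C : ℝ≥0∞, C ≠ ∞ ∧ ∀ a l : ℝ, 0 < l →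
    powerMass s a l ≤ C * (ENNReal.ofReal l * ENNReal.ofReal (|a| + l) ^ s) := by
  have hs' : 0 < s + 1 := by linarith
  set A : ℝ := 3 ^ |s| with hA
  set B : ℝ := 2 / (s + 1) * 3 ^ (s + 1) * A with hB
  have hA0 : 0 < A := by positivity
  have hB0 : 0 < B := by positivity
  refine ⟨ENNReal.ofReal (A + B), ENNReal.ofReal_ne_top, fun a l hl => ?_⟩
  have hM : 0 < |a| + l := by positivity
  rw [ENNReal.ofReal_rpow_of_pos hM, ← ENNReal.ofReal_mul hl.le,
    ← ENNReal.ofReal_mul (by positivity)]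
  have hP : 0 < (|a| + l) ^ s := Real.rpow_pos_of_pos hM s
  rcases le_total |a| (2 * l) with h | h
  · have h3 : 0 < 3 * l := by linarith
    refine (powerMass_le_two_mul (R := 3 * l) ?_ ?_).trans ?_
    · linarith [neg_abs_le a]
    · linarith [le_abs_self a]
    rw [powerMass_zero hs h3, ENNReal.ofReal_rpow_of_pos h3, ← ENNReal.ofReal_mul (by positivity),
      ← ENNReal.ofReal_ofNat 2, ← ENNReal.ofReal_mul (by norm_num)]
    apply ENNReal.ofReal_le_ofReal
    have hls : l ^ s ≤ A * (|a| + l) ^ s :=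
      Real.rpow_le_mul_rpow_of_comparable s hl hM (by linarith [abs_nonneg a]) (by linarith)
    calc 2 * (1 / (s + 1) * (3 * l) ^ (s + 1))
        = 2 / (s + 1) * 3 ^ (s + 1) * (l * l ^ s) := by
          rw [Real.mul_rpow (by norm_num) hl.le, Real.rpow_add_one hl.ne']; ring
      _ ≤ 2 / (s + 1) * 3 ^ (s + 1) * (l * (A * (|a| + l) ^ s)) := by gcongr
      _ = B * (l * (|a| + l) ^ s) := by rw [hB]; ring
      _ ≤ (A + B) * (l * (|a| + l) ^ s) := by gcongr; linarith
  · calc powerMass s a l ≤ ∫⁻ _ in Ico a (a + l), ENNReal.ofReal (A * (|a| + l) ^ s) := by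
          refine setLIntegral_mono measurable_const fun x hx => ENNReal.ofReal_le_ofReal ?_
          have hxa : |x - a| ≤ l := by
            rw [abs_of_nonneg (by linarith [hx.1])]; linarith [hx.2]
          have h4 : |a| ≤ |x| + l := by
            have := abs_sub_abs_le_abs_sub a x
            rw [abs_sub_comm] at this; linarith
          have h5 : |x| ≤ |a| + l := by
            have := abs_sub_abs_le_abs_sub x a
            linarith
          exact Real.rpow_le_mul_rpow_of_comparable s (by linarith) hM (by linarith) (by linarith)
      _ = ENNReal.ofReal (A * (l * (|a| + l) ^ s)) := by
          rw [setLIntegral_const, Real.volume_Ico, ← ENNReal.ofReal_mul (by positivity)]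
          congr 1; ring
      _ ≤ _ := by
          apply ENNReal.ofReal_le_ofReal
          gcongr; linarith

theorem le_powerMass_one (s : ℝ) {N : ℝ} (hN : 1 ≤ N) :
    ENNReal.ofReal (2 ^ |s|)⁻¹ * ENNReal.ofReal N ^ s ≤ powerMass s N 1 := by
  have hN0 : 0 < N := by linarith
  calc ENNReal.ofReal (2 ^ |s|)⁻¹ * ENNReal.ofReal N ^ s
      = ∫⁻ _ in Ico N (N + 1), ENNReal.ofReal ((2 ^ |s|)⁻¹ * N ^ s) := by
        rw [setLIntegral_const, Real.volume_Ico, ENNReal.ofReal_rpow_of_pos hN0,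
          ← ENNReal.ofReal_mul (by positivity)]
        simp
    _ ≤ _ := by
        refine setLIntegral_mono (by fun_prop) fun x hx => ENNReal.ofReal_le_ofReal ?_
        rw [abs_of_pos (hN0.trans_le hx.1), inv_mul_le_iff₀ (by positivity)]
        exact Real.rpow_le_mul_rpow_of_comparable s hN0 (hN0.trans_le hx.1)
          (by linarith [hx.1]) (by linarith [hx.2])

theorem nonpos_of_forall_mul_rpow_le {K T : ℝ≥0∞} {e : ℝ} (hK : K ≠ 0) (hT : T ≠ ∞)
    (h : ∀ x : ℝ, 1 ≤ x → K * ENNReal.ofReal x ^ e ≤ T) : e ≤ 0 := by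
  by_contra! he
  have h1 : Filter.Tendsto (fun x : ℝ => K * ENNReal.ofReal x ^ e) Filter.atTop (nhds ∞) := by
    have := ENNReal.Tendsto.const_mul (a := K)
      (((ENNReal.tendsto_rpow_at_top he).comp ENNReal.tendsto_ofReal_atTop)) (Or.inl ENNReal.top_ne_zero)
    rwa [ENNReal.mul_top hK] at this
  have h2 := le_of_tendsto h1 (Filter.eventually_atTop.2 ⟨1, h⟩)
  exact hT (top_le_iff.1 h2)

/-- The contribution of one coordinate to the two-weight constant of a pair of monomial weights:
`(∫_I |x|^s)^r (∫_I |x|^t)^u` over the interval `I = [a, a + l)`. -/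
noncomputable def pairMass (r u s t a l : ℝ) : ℝ≥0∞ :=
  powerMass s a l ^ r * powerMass t a l ^ u

theorem pairMass_ne_zero {r u : ℝ} (hr : 0 < r) (hu : 0 < u) (s t a : ℝ) {l : ℝ} (hl : 0 < l) :
    pairMass r u s t a l ≠ 0 :=
  mul_ne_zero (ENNReal.rpow_pos_of_nonneg (powerMass_pos s a hl) hr.le).ne'
    (ENNReal.rpow_pos_of_nonneg (powerMass_pos t a hl) hu.le).ne'

theorem pairMass_zero_ne_top {r u s t l : ℝ} (hr : 0 < r) (hu : 0 < u) (hl : 0 < l)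
    (h : pairMass r u s t 0 l ≠ ∞) : -1 < s ∧ -1 < t := by
  have hs : powerMass s 0 l ^ r ≠ ∞ := fun hs => h <| by
    rw [pairMass, hs, ENNReal.top_mul]
    exact (ENNReal.rpow_pos_of_nonneg (powerMass_pos t 0 hl) hu.le).ne'
  have ht : powerMass t 0 l ^ u ≠ ∞ := fun ht => h <| by
    rw [pairMass, ht, ENNReal.mul_top]
    exact (ENNReal.rpow_pos_of_nonneg (powerMass_pos s 0 hl) hr.le).ne'
  refine ⟨neg_one_lt_of_powerMass_ne_top hl fun h' => hs ?_,
    neg_one_lt_of_powerMass_ne_top hl fun h' => ht ?_⟩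
  · rw [h', ENNReal.top_rpow_of_pos hr]
  · rw [h', ENNReal.top_rpow_of_pos hu]

theorem pairMass_zero {r u s t : ℝ} (hr : 0 < r) (hu : 0 < u) (hs : -1 < s) (ht : -1 < t) :
    ∃ K : ℝ≥0∞, K ≠ 0 ∧ ∀ l : ℝ, 0 < l →
      pairMass r u s t 0 l = K * ENNReal.ofReal l ^ (r * (s + 1) + u * (t + 1)) := by
  have hs' : 0 < 1 / (s + 1) := one_div_pos.2 (by linarith)
  have ht' : 0 < 1 / (t + 1) := one_div_pos.2 (by linarith)
  refine ⟨ENNReal.ofReal (1 / (s + 1)) ^ r * ENNReal.ofReal (1 / (t + 1)) ^ u,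
    mul_ne_zero ?_ ?_, fun l hl => ?_⟩
  · exact (ENNReal.rpow_pos (ENNReal.ofReal_pos.2 hs') ENNReal.ofReal_ne_top).ne'
  · exact (ENNReal.rpow_pos (ENNReal.ofReal_pos.2 ht') ENNReal.ofReal_ne_top).ne'
  · rw [pairMass, powerMass_zero hs hl, powerMass_zero ht hl, ENNReal.mul_rpow_of_nonneg _ _ hr.le,
      ENNReal.mul_rpow_of_nonneg _ _ hu.le, ← ENNReal.rpow_mul, ← ENNReal.rpow_mul,
      ENNReal.rpow_add _ _ (ENNReal.ofReal_pos.2 hl).ne' ENNReal.ofReal_ne_top,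
      mul_comm (s + 1), mul_comm (t + 1)]
    ring

theorem le_pairMass_one {r u : ℝ} (hr : 0 < r) (hu : 0 < u) (s t : ℝ) :
    ∃ K : ℝ≥0∞, K ≠ 0 ∧ ∀ N : ℝ, 1 ≤ N →
      K * ENNReal.ofReal N ^ (r * s + u * t) ≤ pairMass r u s t N 1 := by
  refine ⟨ENNReal.ofReal (2 ^ |s|)⁻¹ ^ r * ENNReal.ofReal (2 ^ |t|)⁻¹ ^ u,
    mul_ne_zero ?_ ?_, fun N hN => ?_⟩
  · exact (ENNReal.rpow_pos (ENNReal.ofReal_pos.2 (by positivity)) ENNReal.ofReal_ne_top).ne'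
  · exact (ENNReal.rpow_pos (ENNReal.ofReal_pos.2 (by positivity)) ENNReal.ofReal_ne_top).ne'
  · have hN0 : 0 < N := by linarith
    calc _ = (ENNReal.ofReal (2 ^ |s|)⁻¹ * ENNReal.ofReal N ^ s) ^ r *
          (ENNReal.ofReal (2 ^ |t|)⁻¹ * ENNReal.ofReal N ^ t) ^ u := by
          rw [ENNReal.mul_rpow_of_nonneg _ _ hr.le, ENNReal.mul_rpow_of_nonneg _ _ hu.le,
            ← ENNReal.rpow_mul, ← ENNReal.rpow_mul,
            ENNReal.rpow_add _ _ (ENNReal.ofReal_pos.2 hN0).ne' ENNReal.ofReal_ne_top,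
            mul_comm s, mul_comm t]
          ring
      _ ≤ _ := by
          unfold pairMass
          gcongr
          · exact le_powerMass_one s hN
          · exact le_powerMass_one t hN

theorem pairMass_le {r u s t : ℝ} (hr : 0 < r) (hu : 0 < u) (hs : -1 < s) (ht : -1 < t)
    (hst : r * s + u * t ≤ 0) :
    ∃ C : ℝ≥0∞, C ≠ ∞ ∧ ∀ a l : ℝ, 0 < l →
      pairMass r u s t a l ≤ C * ENNReal.ofReal l ^ (r * (s + 1) + u * (t + 1)) := by
  obtain ⟨C, hC, hCs⟩ := powerMass_le hs
  obtain ⟨D, hD, hDt⟩ := powerMass_le ht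
  refine ⟨C ^ r * D ^ u, ENNReal.mul_ne_top (ENNReal.rpow_ne_top_of_nonneg hr.le hC)
    (ENNReal.rpow_ne_top_of_nonneg hu.le hD), fun a l hl => ?_⟩
  have hM : 0 < |a| + l := by positivity
  have hL0 : ENNReal.ofReal l ≠ 0 := (ENNReal.ofReal_pos.2 hl).ne'
  have hM0 : ENNReal.ofReal (|a| + l) ≠ 0 := (ENNReal.ofReal_pos.2 hM).ne'
  calc pairMass r u s t a l
      ≤ (C * (ENNReal.ofReal l * ENNReal.ofReal (|a| + l) ^ s)) ^ r *
          (D * (ENNReal.ofReal l * ENNReal.ofReal (|a| + l) ^ t)) ^ u := by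
        unfold pairMass
        gcongr
        · exact hCs a l hl
        · exact hDt a l hl
    _ = C ^ r * D ^ u * (ENNReal.ofReal l ^ (r + u) *
          ENNReal.ofReal (|a| + l) ^ (r * s + u * t)) := by
        simp only [ENNReal.mul_rpow_of_nonneg _ _ hr.le, ENNReal.mul_rpow_of_nonneg _ _ hu.le,
          ← ENNReal.rpow_mul, ENNReal.rpow_add _ _ hL0 ENNReal.ofReal_ne_top,
          ENNReal.rpow_add _ _ hM0 ENNReal.ofReal_ne_top, mul_comm s, mul_comm t]
        ring
    _ ≤ C ^ r * D ^ u * (ENNReal.ofReal l ^ (r + u) *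
          ENNReal.ofReal l ^ (r * s + u * t)) := by
        gcongr _ * (_ * ?_)
        rw [ENNReal.ofReal_rpow_of_pos hM, ENNReal.ofReal_rpow_of_pos hl]
        exact ENNReal.ofReal_le_ofReal <| Real.rpow_le_rpow_of_nonpos hl
          (by linarith [abs_nonneg a]) hst
    _ = _ := by
        rw [← ENNReal.rpow_add _ _ hL0 ENNReal.ofReal_ne_top]
        congr 2
        ring

theorem ENNReal.rpow_sum_of_ne_zero_of_ne_top {ι : Type*} (S : Finset ι) (f : ι → ℝ) {x : ℝ≥0∞}
    (hx : x ≠ 0) (hx' : x ≠ ∞) : x ^ ∑ i ∈ S, f i = ∏ i ∈ S, x ^ f i := by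
  classical
  induction S using Finset.induction_on with
  | empty => simp
  | insert i S hi ih =>
    rw [Finset.sum_insert hi, Finset.prod_insert hi, ENNReal.rpow_add _ _ hx hx', ih]

theorem iSup_cube_pairMass_ne_top_iff {d : ℕ} {r u : ℝ} (hr : 0 < r) (hu : 0 < u) (A : ℝ)
    (s t : Fin d → ℝ) :
    (⨆ Q : Cube d, ENNReal.ofReal Q.side ^ A *
        ∏ j, pairMass r u (s j) (t j) (Q.corner j) Q.side) ≠ ∞ ↔
      (∀ j, -1 < s j ∧ -1 < t j) ∧ (∀ j, r * s j + u * t j ≤ 0) ∧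
        A + ∑ j, (r * (s j + 1) + u * (t j + 1)) = 0 := by
  constructor
  · intro h
    set T := ⨆ Q : Cube d, ENNReal.ofReal Q.side ^ A *
        ∏ j, pairMass r u (s j) (t j) (Q.corner j) Q.side
    have hT (a : Fin d → ℝ) (l : ℝ) (hl : 0 < l) :
        ENNReal.ofReal l ^ A * ∏ j, pairMass r u (s j) (t j) (a j) l ≤ T :=
      le_iSup (fun Q : Cube d => ENNReal.ofReal Q.side ^ A *
        ∏ j, pairMass r u (s j) (t j) (Q.corner j) Q.side) ⟨a, l, hl⟩
    have hint : ∀ j, -1 < s j ∧ -1 < t j := by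
      intro j
      refine pairMass_zero_ne_top hr hu one_pos fun htop => ?_
      have h1 := hT (fun _ => 0) 1 one_pos
      rw [ENNReal.ofReal_one, ENNReal.one_rpow, one_mul, ← Finset.mul_prod_erase _ _
        (Finset.mem_univ j), htop, ENNReal.top_mul (Finset.prod_ne_zero_iff.2 fun i _ =>
          pairMass_ne_zero hr hu _ _ _ one_pos)] at h1
      exact h (top_le_iff.1 h1)
    refine ⟨hint, fun j => ?_, ?_⟩
    · obtain ⟨K, hK, hKN⟩ := le_pairMass_one hr hu (s j) (t j)
      set P := ∏ i ∈ Finset.univ.erase j, pairMass r u (s i) (t i) 0 1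
      have hP : P ≠ 0 := Finset.prod_ne_zero_iff.2 fun i _ => pairMass_ne_zero hr hu _ _ _ one_pos
      refine nonpos_of_forall_mul_rpow_le (K := P * K) (T := T) (mul_ne_zero hP hK) h
        fun N hN => ?_
      have h1 := hT (Function.update (fun _ => 0) j N) 1 one_pos
      rw [ENNReal.ofReal_one, ENNReal.one_rpow, one_mul, ← Finset.mul_prod_erase _ _
        (Finset.mem_univ j), Function.update_self] at h1
      have h2 : ∏ i ∈ Finset.univ.erase j, pairMass r u (s i) (t i)
          (Function.update (fun _ => (0 : ℝ)) j N i) 1 = P :=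
        Finset.prod_congr rfl fun i hi => by
          rw [Function.update_of_ne (Finset.ne_of_mem_erase hi)]
      rw [h2] at h1
      calc P * K * ENNReal.ofReal N ^ (r * s j + u * t j)
          = K * ENNReal.ofReal N ^ (r * s j + u * t j) * P := by ring
        _ ≤ pairMass r u (s j) (t j) N 1 * P := by gcongr; exact hKN N hN
        _ ≤ T := h1
    · choose K hK hKl using fun j => pairMass_zero hr hu (hint j).1 (hint j).2
      set E := A + ∑ j, (r * (s j + 1) + u * (t j + 1)) with hE
      have hP : ∏ j, K j ≠ 0 := Finset.prod_ne_zero_iff.2 fun i _ => hK i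
      have key (l : ℝ) (hl : 0 < l) : (∏ j, K j) * ENNReal.ofReal l ^ E ≤ T := by
        have hl0 := (ENNReal.ofReal_pos.2 hl).ne'
        refine le_trans (le_of_eq ?_) (hT (fun _ => 0) l hl)
        simp_rw [fun j => hKl j l hl]
        rw [Finset.prod_mul_distrib, hE, ENNReal.rpow_add _ _ hl0 ENNReal.ofReal_ne_top,
          ENNReal.rpow_sum_of_ne_zero_of_ne_top _ _ hl0 ENNReal.ofReal_ne_top]
        ring
      refine le_antisymm (nonpos_of_forall_mul_rpow_le hP h fun x hx => key x (by linarith)) ?_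
      rw [← neg_nonpos]
      refine nonpos_of_forall_mul_rpow_le hP h fun x hx => ?_
      have hx0 : 0 < x := by linarith
      have h1 := key x⁻¹ (inv_pos.2 hx0)
      rwa [ENNReal.ofReal_inv_of_pos hx0, ENNReal.inv_rpow, ← ENNReal.rpow_neg] at h1
  · rintro ⟨hint, hle, hE⟩
    choose C hC hCl using fun j => pairMass_le hr hu (hint j).1 (hint j).2 (hle j)
    refine ne_top_of_le_ne_top (ENNReal.prod_ne_top (s := Finset.univ) fun j _ => hC j)
      (iSup_le fun Q => ?_)
    have hl0 := (ENNReal.ofReal_pos.2 Q.side_pos).ne'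
    calc ENNReal.ofReal Q.side ^ A * ∏ j, pairMass r u (s j) (t j) (Q.corner j) Q.side
        ≤ ENNReal.ofReal Q.side ^ A *
            ∏ j, (C j * ENNReal.ofReal Q.side ^ (r * (s j + 1) + u * (t j + 1))) := by
          gcongr with j
          exact hCl j _ _ Q.side_pos
      _ = (∏ j, C j) *
            ENNReal.ofReal Q.side ^ (A + ∑ j, (r * (s j + 1) + u * (t j + 1))) := by
          rw [Finset.prod_mul_distrib, ENNReal.rpow_add _ _ hl0 ENNReal.ofReal_ne_top,
            ENNReal.rpow_sum_of_ne_zero_of_ne_top _ _ hl0 ENNReal.ofReal_ne_top]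
          ring
      _ = ∏ j, C j := by rw [hE, ENNReal.rpow_zero, mul_one]

theorem apqConst_monomial {d : ℕ} (hd : 0 < d) {p q : ℝ} (α : ℝ) (hp : 1 < p) (hq : 1 < q)
    (β γ : Fin d → ℝ) :
    apqConst p q α (fun x => ∏ j, |x j| ^ β j) (fun x => ∏ j, |x j| ^ γ j) =
      ⨆ Q : Cube d, ENNReal.ofReal Q.side ^ (α - d) *
        ∏ j, pairMass ((p - 1) / p) (1 / q) (-β j / (p - 1)) (γ j) (Q.corner j) Q.side := by
  have hd' : (d : ℝ) ≠ 0 := by positivity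
  have hp1 : p - 1 ≠ 0 := by linarith
  have hp0 : p ≠ 0 := by linarith
  have hr : 0 ≤ (p - 1) / p := div_nonneg (by linarith) (by linarith)
  have hu : 0 ≤ 1 / q := one_div_nonneg.2 (by linarith)
  have hv (x : Fin d → ℝ) : (∏ j, |x j| ^ β j) ^ (-(p / (p - 1)) / p) =
      ∏ j, |x j| ^ (-β j / (p - 1)) := by
    rw [← Real.finsetProd_rpow _ _ fun j _ => Real.rpow_nonneg (abs_nonneg _) _]
    refine Finset.prod_congr rfl fun j _ => ?_
    rw [← Real.rpow_mul (abs_nonneg _)]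
    congr 1
    field_simp
  refine iSup_congr fun Q => ?_
  simp_rw [hv, Q.lintegral_monomial, Q.volume_toSet_s12, pairMass]
  rw [Finset.prod_mul_distrib, ENNReal.prod_rpow_of_nonneg hr, ENNReal.prod_rpow_of_nonneg hu,
    mul_assoc, ← ENNReal.rpow_natCast, ← ENNReal.rpow_mul]
  congr 2
  field_simp

/-- characterization of the `A_{p,q}^α` condition for monomial weights. -/
theorem apq_alpha_monomial_weights
    {d : ℕ} (hd : 0 < d) (p q α : ℝ) (hp : 1 < p) (hq : 1 < q)
    (β γ : Fin d → ℝ) :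
    apqConst p q α (fun x => ∏ j, |x j| ^ β j) (fun x => ∏ j, |x j| ^ γ j) ≠ ∞ ↔
      ((∀ j, β j < p - 1 ∧ -1 < γ j) ∧ (∀ j, γ j / q ≤ β j / p) ∧
        α + (d : ℝ) / q - (d : ℝ) / p + ∑ j, (γ j / q - β j / p) = 0) := by
  have hp1 : 0 < p - 1 := by linarith
  have hp0 : 0 < p := by linarith
  have hq0 : 0 < q := by linarith
  rw [apqConst_monomial hd α hp hq, iSup_cube_pairMass_ne_top_iff (div_pos hp1 hp0)
    (one_div_pos.2 hq0)]
  have h₁ (j : Fin d) : -1 < -β j / (p - 1) ↔ β j < p - 1 := by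
    rw [lt_div_iff₀ hp1]
    constructor <;> intro h <;> linarith
  have h₂ (j : Fin d) : (p - 1) / p * (-β j / (p - 1)) + 1 / q * γ j = γ j / q - β j / p := by
    field_simp
    ring
  have h₃ (j : Fin d) : (p - 1) / p * (-β j / (p - 1) + 1) + 1 / q * (γ j + 1) =
      (γ j / q - β j / p) + (1 + 1 / q - 1 / p) := by
    field_simp
    ring
  simp_rw [h₁, h₂, h₃, sub_nonpos]
  rw [Finset.sum_add_distrib, Finset.sum_const, Finset.card_univ, Fintype.card_fin, nsmul_eq_mul]
  have h₄ : α - d + (∑ j, (γ j / q - β j / p) + d * (1 + 1 / q - 1 / p)) =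
      α + (d : ℝ) / q - (d : ℝ) / p + ∑ j, (γ j / q - β j / p) := by ring
  rw [h₄]
end
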